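/- arXiv:1811.06823 — 5 statements merged into one kernel-verified Lean document; each statement's English description precedes it below -/
import Mathlib

section
/- Let c > 1 be a real number. There exists a real constant d > 0 (depending only on c) such that for every c-fat compact convex set K in the Euclidean plane ℝ² and any two points a, b on the topological frontier of K, there exists a continuous map γ : [0,1] → ℝ² with γ 0 = a, γ 1 = b, whose image is contained in the frontier of K, and whose length (total variation of γ over [0,1]) is at most d · dist a b. -/
open scoped Topology

/-- How rescaling two vectors by the inverses of positive scalars affects their distance. -/
theorem norm_inv_smul_sub_inv_smul_le {E : Type*} [NormedAddCommGroup E] [NormedSpace ℝ E]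
    {G H : ℝ} (hG : 0 < G) (hH : 0 < H) (x y : E) :
    ‖G⁻¹ • x - H⁻¹ • y‖ ≤ G⁻¹ * ‖x - y‖ + G⁻¹ * |G - H| * (H⁻¹ * ‖y‖) := by
  have h : G⁻¹ • x - H⁻¹ • y = G⁻¹ • (x - y) + (G⁻¹ * (H - G)) • (H⁻¹ • y) := by
    have e : G⁻¹ * (H - G) * H⁻¹ = G⁻¹ - H⁻¹ := by field_simp
    rw [smul_smul, e, smul_sub, sub_smul]
    abel
  rw [h]
  refine (norm_add_le _ _).trans_eq ?_
  simp only [norm_smul, norm_mul, norm_inv, Real.norm_eq_abs, abs_of_pos hG, abs_of_pos hH,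
    abs_sub_comm H G]

/-- Radial projection to the unit sphere is Lipschitz away from the origin. -/
theorem norm_normalize_sub_normalize_le {E : Type*} [NormedAddCommGroup E] [NormedSpace ℝ E]
    {r : ℝ} (hr : 0 < r) {x y : E} (hx : r ≤ ‖x‖) (hy : r ≤ ‖y‖) :
    ‖‖x‖⁻¹ • x - ‖y‖⁻¹ • y‖ ≤ 2 * r⁻¹ * ‖x - y‖ := by
  have hx0 := hr.trans_le hx
  have hy0 := hr.trans_le hy
  have h := norm_inv_smul_sub_inv_smul_le hx0 hy0 x y
  rw [inv_mul_cancel₀ hy0.ne', mul_one] at h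
  calc _ ≤ _ := h
    _ ≤ ‖x‖⁻¹ * ‖x - y‖ + ‖x‖⁻¹ * ‖x - y‖ := by gcongr; exact abs_norm_sub_norm_le x y
    _ ≤ r⁻¹ * ‖x - y‖ + r⁻¹ * ‖x - y‖ := by gcongr
    _ = _ := by ring

/-- Two points of the unit circle are joined by an arc whose speed is at most `π / 2` times
their distance. -/
theorem Complex.exists_lipschitz_arc {u v : ℂ} (hu : ‖u‖ = 1) (hv : ‖v‖ = 1) :
    ∃ σ : ℝ → ℂ, σ 0 = u ∧ σ 1 = v ∧ (∀ t, ‖σ t‖ = 1) ∧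
      ∀ s t, ‖σ s - σ t‖ ≤ Real.pi / 2 * ‖u - v‖ * |s - t| := by
  have hu0 : u ≠ 0 := norm_ne_zero_iff.1 (by simp [hu])
  have hv0 : v ≠ 0 := norm_ne_zero_iff.1 (by simp [hv])
  have harg : |(v / u).arg| ≤ Real.pi / 2 * ‖u - v‖ := by
    have h := Complex.angle_le_mul_norm_sub hv hu
    rwa [Complex.angle_eq_abs_arg hv0 hu0, norm_sub_rev] at h
  refine ⟨fun t ↦ u * Complex.exp (Complex.I * (((v / u).arg * t : ℝ) : ℂ)), by simp, ?_, ?_, ?_⟩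
  · have h := Complex.norm_mul_exp_arg_mul_I (v / u)
    rw [norm_div, hu, hv, div_one, Complex.ofReal_one, one_mul] at h
    simp only [mul_one]
    rw [mul_comm Complex.I, h, mul_div_cancel₀ _ hu0]
  · intro t
    rw [norm_mul, hu, one_mul, mul_comm, Complex.norm_exp_ofReal_mul_I]
  · intro s t
    have e : u * Complex.exp (Complex.I * (((v / u).arg * s : ℝ) : ℂ)) -
        u * Complex.exp (Complex.I * (((v / u).arg * t : ℝ) : ℂ)) =
        u * (Complex.exp ((((v / u).arg * t : ℝ) : ℂ) * Complex.I) *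
          (Complex.exp (Complex.I * (((v / u).arg * (s - t) : ℝ) : ℂ)) - 1)) := by
      rw [mul_sub, ← Complex.exp_add, mul_sub, mul_one]
      congr 3 <;> (push_cast; ring_nf)
    simp only [e]
    rw [norm_mul, hu, one_mul, norm_mul, Complex.norm_exp_ofReal_mul_I, one_mul]
    refine (Real.norm_exp_I_mul_ofReal_sub_one_le).trans ?_
    rw [Real.norm_eq_abs, abs_mul]
    gcongr

/-- Two unit vectors of the Euclidean plane are joined by an arc of the unit circle whose speed
is at most `π / 2` times their distance. -/
theorem EuclideanSpace.exists_lipschitz_arc {u v : EuclideanSpace ℝ (Fin 2)}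
    (hu : ‖u‖ = 1) (hv : ‖v‖ = 1) :
    ∃ σ : ℝ → EuclideanSpace ℝ (Fin 2), σ 0 = u ∧ σ 1 = v ∧ (∀ t, ‖σ t‖ = 1) ∧
      ∀ s t, ‖σ s - σ t‖ ≤ Real.pi / 2 * ‖u - v‖ * |s - t| := by
  let e := Complex.orthonormalBasisOneI.repr
  obtain ⟨σ, h0, h1, hσ, hL⟩ := Complex.exists_lipschitz_arc (u := e.symm u) (v := e.symm v)
    (by simpa using hu) (by simpa using hv)
  refine ⟨fun t ↦ e (σ t), by simp [h0], by simp [h1], fun t ↦ by simpa using hσ t, ?_⟩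
  intro s t
  have h := hL s t
  rwa [← map_sub, LinearIsometryEquiv.norm_map, ← LinearIsometryEquiv.norm_map e, map_sub] at h

/-- The frontier of a convex body with a ball of radius `r` around the origin inside and a ball of
radius `M` outside admits short paths between any two of its points. -/
theorem exists_short_frontier_path {S : Set (EuclideanSpace ℝ (Fin 2))} (hS : Convex ℝ S)
    {r M : ℝ} (hr : 0 < r) (hM : 0 < M) (hin : Metric.ball 0 r ⊆ S)
    (hout : S ⊆ Metric.closedBall 0 M) {p q : EuclideanSpace ℝ (Fin 2)}
    (hp : p ∈ frontier S) (hq : q ∈ frontier S) :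
    ∃ γ : ℝ → EuclideanSpace ℝ (Fin 2), γ 0 = p ∧ γ 1 = q ∧ (∀ t, γ t ∈ frontier S) ∧
      ∀ s t, ‖γ s - γ t‖ ≤ Real.pi * (M / r + (M / r) ^ 2) * ‖p - q‖ * |s - t| := by
  have hnhds : S ∈ 𝓝 (0 : EuclideanSpace ℝ (Fin 2)) :=
    Filter.mem_of_superset (Metric.ball_mem_nhds 0 hr) hin
  have hfr (x) : gauge S x = 1 ↔ x ∈ frontier S := gauge_eq_one_iff_mem_frontier hS hnhds
  have hnorm {x} (hx : x ∈ frontier S) : r ≤ ‖x‖ := by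
    have h := mul_gauge_le_norm (x := x) hin
    rwa [(hfr x).2 hx, mul_one] at h
  have hlip (x y) : |gauge S x - gauge S y| ≤ r⁻¹ * ‖x - y‖ := by
    have h := (hS.lipschitzWith_gauge (r := ⟨r, hr.le⟩) hr hin).dist_le_mul x y
    rwa [Real.dist_eq, dist_eq_norm] at h
  have hlow {x : EuclideanSpace ℝ (Fin 2)} (hx : ‖x‖ = 1) : M⁻¹ ≤ gauge S x := by
    have h := le_gauge_of_subset_closedBall (x := x) (absorbent_nhds_zero hnhds) hM.le hout
    rwa [hx, one_div] at h
  have hpos {x : EuclideanSpace ℝ (Fin 2)} (hx : ‖x‖ = 1) : 0 < gauge S x :=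
    (inv_pos.2 hM).trans_le (hlow hx)
  have hunit {x : EuclideanSpace ℝ (Fin 2)} (hx : x ∈ frontier S) : ‖‖x‖⁻¹ • x‖ = 1 := by
    rw [norm_smul, norm_inv, norm_norm, inv_mul_cancel₀ (hr.trans_le (hnorm hx)).ne']
  have hback {x : EuclideanSpace ℝ (Fin 2)} (hx : x ∈ frontier S) :
      (gauge S (‖x‖⁻¹ • x))⁻¹ • ‖x‖⁻¹ • x = x := by
    rw [gauge_smul_of_nonneg (by positivity), (hfr x).2 hx, smul_eq_mul, mul_one, inv_inv,
      smul_inv_smul₀ (hr.trans_le (hnorm hx)).ne']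
  obtain ⟨σ, h0, h1, hσ, hL⟩ := EuclideanSpace.exists_lipschitz_arc (hunit hp) (hunit hq)
  refine ⟨fun t ↦ (gauge S (σ t))⁻¹ • σ t, ?_, ?_, fun t ↦ ?_, fun s t ↦ ?_⟩
  · simp only [h0, hback hp]
  · simp only [h1, hback hq]
  · have h := hpos (hσ t)
    rw [← hfr, gauge_smul_of_nonneg (by positivity), smul_eq_mul, inv_mul_cancel₀ h.ne']
  · have hs := hpos (hσ s)
    have ht := hpos (hσ t)
    have hs' : (gauge S (σ s))⁻¹ ≤ M := inv_le_of_inv_le₀ hM (hlow (hσ s))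
    have ht' : (gauge S (σ t))⁻¹ ≤ M := inv_le_of_inv_le₀ hM (hlow (hσ t))
    calc _ ≤ _ := norm_inv_smul_sub_inv_smul_le hs ht (σ s) (σ t)
      _ ≤ M * ‖σ s - σ t‖ + M * (r⁻¹ * ‖σ s - σ t‖) * (M * 1) := by
        rw [hσ t]
        gcongr
        exact hlip _ _
      _ = (M + M ^ 2 * r⁻¹) * ‖σ s - σ t‖ := by ring
      _ ≤ (M + M ^ 2 * r⁻¹) * (Real.pi / 2 * (2 * r⁻¹ * ‖p - q‖) * |s - t|) := by
        gcongr
        refine (hL s t).trans ?_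
        gcongr
        exact norm_normalize_sub_normalize_le hr (hnorm hp) (hnorm hq)
      _ = _ := by
        field_simp


/-- A compact convex set `K` in the Euclidean plane is `c`-fat if there are points `z, w`
and radii `0 < r ≤ R` with `R ≤ c * r` such that the closed ball of radius `r` around `z`
is contained in `K` and `K` is contained in the closed ball of radius `R` around `w`. -/
def CFat (c : ℝ) (K : Set (EuclideanSpace ℝ (Fin 2))) : Prop :=
  ∃ (z w : EuclideanSpace ℝ (Fin 2)) (r R : ℝ), 0 < r ∧ r ≤ R ∧ R ≤ c * r ∧
    Metric.closedBall z r ⊆ K ∧ K ⊆ Metric.closedBall w R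

/-- For every `c > 1` there is a constant `d > 0` such that any two points on the frontier
of a `c`-fat compact convex set `K` are joined by a continuous path along the frontier of
length at most `d` times their distance. -/
theorem boundary_path_of_cFat (c : ℝ) (hc : 1 < c) :
    ∃ d : ℝ, 0 < d ∧
      ∀ K : Set (EuclideanSpace ℝ (Fin 2)), IsCompact K → Convex ℝ K → CFat c K →
        ∀ a ∈ frontier K, ∀ b ∈ frontier K,
          ∃ γ : ℝ → EuclideanSpace ℝ (Fin 2),
            ContinuousOn γ (Set.Icc 0 1) ∧ γ 0 = a ∧ γ 1 = b ∧
            γ '' Set.Icc 0 1 ⊆ frontier K ∧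
            eVariationOn γ (Set.Icc 0 1) ≤ ENNReal.ofReal (d * dist a b) := by
  have hc0 : 0 < c := one_pos.trans hc
  refine ⟨Real.pi * (2 * c + (2 * c) ^ 2), by positivity, ?_⟩
  rintro K - hK ⟨z, w, r, R, hr, hrR, hRc, hin, hout⟩ a ha b hb
  have hR : 0 < R := hr.trans_le hrR
  have hfr : frontier ((fun x ↦ z + x) ⁻¹' K) = (fun x ↦ z + x) ⁻¹' frontier K :=
    ((Homeomorph.addLeft z).preimage_frontier K).symm
  have hin' : Metric.ball 0 r ⊆ (fun x ↦ z + x) ⁻¹' K := by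
    intro x hx
    apply hin
    simpa [dist_eq_norm] using (mem_ball_zero_iff.1 hx).le
  have hout' : (fun x ↦ z + x) ⁻¹' K ⊆ Metric.closedBall 0 (2 * R) := by
    intro x hx
    have hz := Metric.mem_closedBall.1 (hout (hin (Metric.mem_closedBall_self hr.le)))
    have hx' := Metric.mem_closedBall.1 (hout hx)
    have h := dist_triangle_right (z + x) z w
    rw [dist_eq_norm, add_sub_cancel_left] at h
    rw [mem_closedBall_zero_iff]
    linarith
  obtain ⟨γ, h0, h1, hγ, hL⟩ := exists_short_frontier_path (hK.translate_preimage_right z)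
    hr (by positivity) hin' hout' (p := a - z) (q := b - z)
    (by rw [hfr]; simpa using ha) (by rw [hfr]; simpa using hb)
  have hratio : 2 * R / r ≤ 2 * c := by
    rw [div_le_iff₀ hr]
    linarith
  have hlip : LipschitzWith (Real.toNNReal (Real.pi * (2 * c + (2 * c) ^ 2) * dist a b))
      (fun t ↦ z + γ t) := by
    refine LipschitzWith.of_dist_le_mul fun s t ↦ ?_
    rw [Real.coe_toNNReal _ (by positivity), dist_add_left, dist_eq_norm, Real.dist_eq]
    refine (hL s t).trans ?_
    rw [sub_sub_sub_cancel_right, ← dist_eq_norm]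
    gcongr
  refine ⟨fun t ↦ z + γ t, hlip.continuous.continuousOn, by simp [h0], by simp [h1], ?_, ?_⟩
  · rintro _ ⟨t, -, rfl⟩
    have h := hγ t
    rwa [hfr] at h
  · calc eVariationOn ((fun t ↦ z + γ t) ∘ id) (Set.Icc 0 1)
        ≤ _ * eVariationOn id (Set.Icc (0 : ℝ) 1) :=
          (hlip.lipschitzOnWith (s := Set.univ)).comp_eVariationOn_le (Set.mapsTo_univ _ _)
      _ ≤ ENNReal.ofReal (Real.pi * (2 * c + (2 * c) ^ 2) * dist a b) * ENNReal.ofReal (1 - 0) := by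
          gcongr
          · exact le_rfl
          · simp
      _ = _ := by simp
end

section
/- Let c > 1 be a real number. There exists a real constant k ≥ 1 (depending only on c) such that the following holds. Let O₁, …, O_t be finitely many pairwise disjoint open convex subsets of the Euclidean plane ℝ², each of whose closures is a c-fat compact convex set. Then for all points p, q ∈ ℝ² with p ∉ Oᵢ and q ∉ Oᵢ for every i, there exists a continuous map γ : [0,1] → ℝ² with γ 0 = p, γ 1 = q, whose image is disjoint from every Oᵢ, and whose length (total variation over [0,1]) is at most k · dist p q. -/
/-- `F` contains a path from `x` to `y`, parametrised by `[0, L]` with speed at most one. -/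
def JoinedWithin {E : Type*} [PseudoMetricSpace E] (F : Set E) (L : ℝ) (x y : E) : Prop :=
  0 ≤ L ∧ ∃ γ : ℝ → E, (∀ s ∈ Set.Icc 0 L, ∀ t ∈ Set.Icc 0 L, dist (γ s) (γ t) ≤ |s - t|) ∧
    γ 0 = x ∧ γ L = y ∧ ∀ s ∈ Set.Icc 0 L, γ s ∈ F

namespace JoinedWithin

section Metric

variable {E : Type*} [PseudoMetricSpace E] {F : Set E} {L L' C : ℝ} {x y z : E}

lemma mono (h : JoinedWithin F L x y) (hL : L ≤ L') : JoinedWithin F L' x y := by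
  obtain ⟨h0, γ, hγ, hx, hy, hF⟩ := h
  have hm : ∀ s ∈ Set.Icc 0 L', min s L ∈ Set.Icc 0 L := fun s hs =>
    ⟨le_min hs.1 h0, min_le_right _ _⟩
  refine ⟨h0.trans hL, fun s => γ (min s L), fun s hs t ht => ?_, ?_, ?_, fun s hs => ?_⟩
  · exact (hγ _ (hm s hs) _ (hm t ht)).trans
      ((abs_min_sub_min_le_max s L t L).trans (by simp))
  · simpa [min_eq_left h0] using hx
  · simpa [min_eq_right hL] using hy
  · exact hF _ (hm s hs)

lemma map {E' : Type*} [PseudoMetricSpace E'] {F' : Set E'} {f : E → E'} (hf : Isometry f)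
    (hF : Set.MapsTo f F F') (h : JoinedWithin F L x y) : JoinedWithin F' L (f x) (f y) := by
  obtain ⟨h0, γ, hγ, rfl, rfl, hγF⟩ := h
  exact ⟨h0, f ∘ γ, fun s hs t ht => by simpa [hf.dist_eq] using hγ s hs t ht, rfl, rfl,
    fun s hs => hF (hγF s hs)⟩

lemma trans (h : JoinedWithin F L x y) (h' : JoinedWithin F L' y z) :
    JoinedWithin F (L + L') x z := by
  obtain ⟨h0, γ, hγ, hx, hy, hF⟩ := h
  obtain ⟨h0', δ, hδ, hx', hy', hF'⟩ := h'
  have key : ∀ s ∈ Set.Icc 0 (L + L'), ∀ t ∈ Set.Icc 0 (L + L'), s ≤ t →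
      dist (if s ≤ L then γ s else δ (s - L)) (if t ≤ L then γ t else δ (t - L)) ≤ |s - t| := by
    intro s hs t ht hst
    split_ifs with h1 h2 h2
    · exact hγ s ⟨hs.1, h1⟩ t ⟨ht.1, h2⟩
    · have e1 := hγ s ⟨hs.1, h1⟩ L ⟨h0, le_rfl⟩
      have e2 := hδ 0 ⟨le_rfl, h0'⟩ (t - L) ⟨by linarith, by linarith [ht.2]⟩
      rw [hy, abs_of_nonpos (by linarith)] at e1
      rw [hx', abs_of_nonpos (by linarith)] at e2
      rw [abs_of_nonpos (by linarith)]
      linarith [dist_triangle (γ s) y (δ (t - L))]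
    · exact absurd (hst.trans h2) h1
    · simpa using hδ (s - L) ⟨by linarith, by linarith [hs.2]⟩ (t - L)
        ⟨by linarith, by linarith [ht.2]⟩
  refine ⟨by positivity, fun s => if s ≤ L then γ s else δ (s - L), fun s hs t ht => ?_, ?_, ?_,
    fun s hs => ?_⟩
  · rcases le_total s t with hst | hst
    · exact key s hs t ht hst
    · rw [dist_comm, abs_sub_comm]
      exact key t ht s hs hst
  · simpa [h0] using hx
  · by_cases hL : L' ≤ 0
    · obtain rfl : L' = 0 := le_antisymm hL h0'
      simp [hy, ← hx', hy']
    · simpa [hL] using hy'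
  · dsimp only
    split_ifs with h1
    · exact hF s ⟨hs.1, h1⟩
    · exact hF' _ ⟨by linarith, by linarith [hs.2]⟩

end Metric

/-- A `C`-Lipschitz path on `[0, 1]` can be reparametrised on `[0, C]` with unit speed bound. -/
lemma of_lipschitz {E : Type*} [MetricSpace E] {F : Set E} {C : ℝ} {f : ℝ → E} (hC : 0 ≤ C)
    (hf : ∀ s ∈ Set.Icc (0 : ℝ) 1, ∀ t ∈ Set.Icc (0 : ℝ) 1, dist (f s) (f t) ≤ C * |s - t|)
    (hF : ∀ s ∈ Set.Icc (0 : ℝ) 1, f s ∈ F) : JoinedWithin F C (f 0) (f 1) := by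
  have hm : ∀ s ∈ Set.Icc 0 C, s / C ∈ Set.Icc (0 : ℝ) 1 := fun s hs =>
    ⟨div_nonneg hs.1 hC, div_le_one_of_le₀ hs.2 hC⟩
  refine ⟨hC, fun s => f (s / C), fun s hs t ht => ?_, by simp, ?_, fun s hs => hF _ (hm s hs)⟩
  · refine (hf _ (hm s hs) _ (hm t ht)).trans ?_
    rcases hC.eq_or_lt with rfl | hC
    · simp
    · rw [← sub_div, abs_div, abs_of_pos hC, mul_div_cancel₀ _ hC.ne']
  · rcases hC.eq_or_lt with rfl | hC
    · simpa using hf 0 (by simp) 1 (by simp)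
    · simp [hC.ne']

lemma exists_path {E : Type*} [PseudoMetricSpace E] {F : Set E} {L : ℝ} {x y : E}
    (h : JoinedWithin F L x y) :
    ∃ γ : ℝ → E, ContinuousOn γ (Set.Icc 0 1) ∧ γ 0 = x ∧ γ 1 = y ∧ γ '' Set.Icc 0 1 ⊆ F ∧
      eVariationOn γ (Set.Icc 0 1) ≤ ENNReal.ofReal L := by
  obtain ⟨h0, γ, hγ, hx, hy, hF⟩ := h
  have hm : ∀ s ∈ Set.Icc (0 : ℝ) 1, L * s ∈ Set.Icc 0 L := fun s hs =>
    ⟨mul_nonneg h0 hs.1, mul_le_of_le_one_right h0 hs.2⟩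
  have hlip : LipschitzOnWith L.toNNReal (fun s => γ (L * s)) (Set.Icc 0 1) := by
    refine LipschitzOnWith.of_dist_le_mul fun s hs t ht => ?_
    refine (hγ _ (hm s hs) _ (hm t ht)).trans_eq ?_
    rw [← mul_sub, abs_mul, abs_of_nonneg h0, Real.coe_toNNReal L h0, Real.dist_eq]
  refine ⟨fun s => γ (L * s), hlip.continuousOn, by simpa using hx, by simpa using hy, ?_, ?_⟩
  · rintro _ ⟨s, hs, rfl⟩
    exact hF _ (hm s hs)
  · refine (hlip.comp_eVariationOn_le (g := id) (Set.mapsTo_id _)).trans ?_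
    have := (monotone_id.monotoneOn (Set.Icc (0 : ℝ) 1)).eVariationOn_eq
      (a := 0) (b := 1) (by simp) (by simp)
    rw [Set.inter_self] at this
    rw [this]
    simp [ENNReal.ofReal]

end JoinedWithin

lemma joinedWithin_of_segment_subset {E : Type*} [NormedAddCommGroup E] [NormedSpace ℝ E]
    {F : Set E} {x y : E} (h : segment ℝ x y ⊆ F) : JoinedWithin F (dist x y) x y := by
  have := JoinedWithin.of_lipschitz (F := F) (f := AffineMap.lineMap x y) (C := dist x y)
    dist_nonneg (fun s _ t _ => by rw [dist_lineMap_lineMap, Real.dist_eq, mul_comm])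
    (fun s hs => h (segment_eq_image_lineMap ℝ x y ▸ Set.mem_image_of_mem _ hs))
  simpa using this

/-- The radial map `x ↦ (g x)⁻¹ • x` is Lipschitz away from the origin. -/
lemma norm_inv_smul_sub_inv_smul_le_s1 {E : Type*} [NormedAddCommGroup E] [NormedSpace ℝ E]
    {g : E → ℝ} {K m : ℝ} (hm : 0 < m) (hg : ∀ x y, |g x - g y| ≤ K * ‖x - y‖)
    (hgm : ∀ x, m * ‖x‖ ≤ g x) {x y : E} (hx : x ≠ 0) (hy : y ≠ 0) :
    ‖(g x)⁻¹ • x - (g y)⁻¹ • y‖ ≤ (m * ‖x‖)⁻¹ * (1 + K / m) * ‖x - y‖ := by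
  have hx' : 0 < m * ‖x‖ := mul_pos hm (norm_pos_iff.2 hx)
  have hgx : 0 < g x := hx'.trans_le (hgm x)
  have hgy : 0 < g y := (mul_pos hm (norm_pos_iff.2 hy)).trans_le (hgm y)
  have e : (g x)⁻¹ • x - (g y)⁻¹ • y = (g x)⁻¹ • ((x - y) + ((g y - g x) * (g y)⁻¹) • y) := by
    have : (g x)⁻¹ * ((g y - g x) * (g y)⁻¹) = (g x)⁻¹ - (g y)⁻¹ := by field_simp
    rw [smul_add, smul_smul, this, smul_sub, sub_smul]
    abel
  have hy1 : (g y)⁻¹ * ‖y‖ ≤ m⁻¹ := by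
    rw [inv_mul_le_iff₀ hgy, ← div_eq_mul_inv, le_div_iff₀ hm, mul_comm]
    exact hgm y
  have h2 : ‖((g y - g x) * (g y)⁻¹) • y‖ ≤ K * ‖x - y‖ * m⁻¹ := by
    rw [norm_smul, Real.norm_eq_abs, abs_mul, abs_of_pos (inv_pos.2 hgy), mul_assoc, abs_sub_comm]
    exact mul_le_mul (hg x y) hy1 (by positivity) ((abs_nonneg _).trans (hg x y))
  rw [e, norm_smul, Real.norm_eq_abs, abs_of_pos (inv_pos.2 hgx), mul_assoc]
  refine mul_le_mul (inv_anti₀ hx' (hgm x)) ((norm_add_le _ _).trans ?_) (norm_nonneg _)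
    (by positivity)
  calc _ ≤ ‖x - y‖ + K * ‖x - y‖ * m⁻¹ := by gcongr
    _ = _ := by ring

section Frontier

variable {E : Type*} [NormedAddCommGroup E] [InnerProductSpace ℝ E] {s : Set E} {r D : ℝ}

lemma joinedWithin_frontier_of_inner_nonneg (hs : Convex ℝ s) (hr : 0 < r) (hD : 0 < D)
    (hrs : Metric.ball 0 r ⊆ s) (hsD : s ⊆ Metric.closedBall 0 D) {u v : E} (hu : ‖u‖ = 1)
    (hv : ‖v‖ = 1) (huv : 0 ≤ inner ℝ u v) :
    JoinedWithin (frontier s) (2 * (D * (1 + D / r)) * ‖u - v‖)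
      ((gauge s u)⁻¹ • u) ((gauge s v)⁻¹ • v) := by
  have hs0 : s ∈ nhds 0 := Filter.mem_of_superset (Metric.ball_mem_nhds 0 hr) hrs
  have hg : ∀ x y, |gauge s x - gauge s y| ≤ r⁻¹ * ‖x - y‖ := fun x y => by
    have := (hs.lipschitzWith_gauge (r := ⟨r, hr.le⟩) hr hrs).dist_le_mul x y
    rwa [Real.dist_eq, dist_eq_norm] at this
  have hgm : ∀ x, D⁻¹ * ‖x‖ ≤ gauge s x := fun x => by
    rw [inv_mul_eq_div]
    exact le_gauge_of_subset_closedBall (absorbent_nhds_zero hs0) hD.le hsD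
  have hn : ∀ t ∈ Set.Icc (0 : ℝ) 1, 1 / 2 ≤ ‖AffineMap.lineMap u v t‖ := fun t ht => by
    refine le_of_sq_le_sq ?_ (norm_nonneg _)
    rw [AffineMap.lineMap_apply_module, norm_add_sq_real, norm_smul, norm_smul, hu, hv,
      inner_smul_left, inner_smul_right]
    have : 0 ≤ (1 - t) * (t * inner ℝ u v) :=
      mul_nonneg (by linarith [ht.2]) (mul_nonneg ht.1 huv)
    simp only [mul_one, Real.norm_eq_abs, sq_abs, conj_trivial]
    nlinarith [sq_nonneg (2 * t - 1)]
  have hn0 : ∀ t ∈ Set.Icc (0 : ℝ) 1, (AffineMap.lineMap u v t : E) ≠ 0 := fun t ht h => by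
    have := hn t ht
    rw [h, norm_zero] at this
    norm_num at this
  have := JoinedWithin.of_lipschitz (F := frontier s) (C := 2 * (D * (1 + D / r)) * ‖u - v‖)
    (f := fun t : ℝ => (gauge s (AffineMap.lineMap u v t))⁻¹ • (AffineMap.lineMap u v t : E))
    (by positivity) (fun a ha b hb => ?_) (fun t ht => ?_)
  · simpa using this
  · rw [dist_eq_norm]
    refine (norm_inv_smul_sub_inv_smul_le_s1 (inv_pos.2 hD) hg hgm (hn0 a ha) (hn0 b hb)).trans ?_
    rw [← dist_eq_norm (AffineMap.lineMap u v a : E), dist_lineMap_lineMap, Real.dist_eq,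
      dist_eq_norm, mul_inv, inv_inv, div_inv_eq_mul]
    have h2 : ‖(AffineMap.lineMap u v a : E)‖⁻¹ ≤ 2 :=
      (inv_anti₀ (by norm_num) (hn a ha)).trans (by norm_num)
    calc _ ≤ D * 2 * (1 + r⁻¹ * D) * (|a - b| * ‖u - v‖) := by gcongr
      _ = _ := by ring
  · rw [← gauge_eq_one_iff_mem_frontier hs hs0]
    have hpos : 0 < gauge s (AffineMap.lineMap u v t : E) :=
      (mul_pos (inv_pos.2 hD) (norm_pos_iff.2 (hn0 t ht))).trans_le (hgm _)
    rw [gauge_smul_of_nonneg (inv_nonneg.2 hpos.le), smul_eq_mul, inv_mul_cancel₀ hpos.ne']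

end Frontier

lemma exists_unit_orthogonal_inner_nonneg {u : EuclideanSpace ℝ (Fin 2)} (hu : ‖u‖ = 1)
    (v : EuclideanSpace ℝ (Fin 2)) :
    ∃ m : EuclideanSpace ℝ (Fin 2), ‖m‖ = 1 ∧ inner ℝ u m = 0 ∧ 0 ≤ inner ℝ m v := by
  have h1 : ‖!₂[-u 1, u 0]‖ = 1 := by
    rw [← hu, EuclideanSpace.norm_eq, EuclideanSpace.norm_eq]
    simp [Fin.sum_univ_two, add_comm]
  have h2 : inner ℝ u !₂[-u 1, u 0] = 0 := by
    simp [PiLp.inner_apply, Fin.sum_univ_two]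
    ring
  rcases le_total 0 (inner ℝ !₂[-u 1, u 0] v) with h | h
  · exact ⟨_, h1, h2, h⟩
  · exact ⟨-!₂[-u 1, u 0], by rw [norm_neg, h1], by rw [inner_neg_right, h2, neg_zero],
      by rw [inner_neg_left]; linarith⟩

/-- Two boundary points of a convex planar set lying between two concentric discs are joined by a
path in the boundary whose length is comparable to their distance. -/
lemma joinedWithin_frontier {s : Set (EuclideanSpace ℝ (Fin 2))} {r D : ℝ} (hs : Convex ℝ s)
    (hr : 0 < r) (hD : 0 < D) (hrs : Metric.ball 0 r ⊆ s) (hsD : s ⊆ Metric.closedBall 0 D)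
    {a b : EuclideanSpace ℝ (Fin 2)} (ha : a ∈ frontier s) (hb : b ∈ frontier s) :
    JoinedWithin (frontier s) (8 * (D / r) * (1 + D / r) * dist a b) a b := by
  have hs0 : s ∈ nhds 0 := Filter.mem_of_superset (Metric.ball_mem_nhds 0 hr) hrs
  have hfr : ∀ x ∈ frontier s, r ≤ ‖x‖ ∧ x ≠ 0 ∧ gauge s x = 1 := fun x hx => by
    have h1 := (gauge_eq_one_iff_mem_frontier hs hs0).2 hx
    have h2 := mul_gauge_le_norm (x := x) hrs
    rw [h1, mul_one] at h2
    exact ⟨h2, norm_pos_iff.1 (hr.trans_le h2), h1⟩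
  obtain ⟨hra, ha0, hga⟩ := hfr a ha
  obtain ⟨-, hb0, hgb⟩ := hfr b hb
  have hback : ∀ x : EuclideanSpace ℝ (Fin 2), x ≠ 0 → gauge s x = 1 →
      (gauge s (‖x‖⁻¹ • x))⁻¹ • (‖x‖⁻¹ • x) = x := fun x hx hg => by
    rw [gauge_smul_of_nonneg (by positivity), hg, smul_eq_mul, mul_one, inv_inv, smul_smul,
      mul_inv_cancel₀ (norm_ne_zero_iff.2 hx), one_smul]
  have huv : ‖‖a‖⁻¹ • a - ‖b‖⁻¹ • b‖ ≤ 2 / r * dist a b := by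
    refine (norm_inv_smul_sub_inv_smul_le_s1 (g := norm) (K := 1) one_pos
      (fun x y => by simpa using abs_norm_sub_norm_le x y) (by simp) ha0 hb0).trans ?_
    have : ‖a‖⁻¹ ≤ r⁻¹ := inv_anti₀ hr hra
    rw [one_mul, ← dist_eq_norm]
    calc _ ≤ r⁻¹ * (1 + 1 / 1) * dist a b := by gcongr
      _ = _ := by ring
  have hu : ‖‖a‖⁻¹ • a‖ = 1 := norm_smul_inv_norm ha0
  have hv : ‖‖b‖⁻¹ • b‖ = 1 := norm_smul_inv_norm hb0
  have key : JoinedWithin (frontier s)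
      (2 * (2 * (D * (1 + D / r)) * ‖‖a‖⁻¹ • a - ‖b‖⁻¹ • b‖)) a b := by
    have hpa := hback a ha0 hga
    have hpb := hback b hb0 hgb
    generalize ‖a‖⁻¹ • a = u at *
    generalize ‖b‖⁻¹ • b = v at *
    rw [← hpa, ← hpb]
    rcases le_total 0 (inner ℝ u v) with h | h
    · refine (joinedWithin_frontier_of_inner_nonneg hs hr hD hrs hsD hu hv h).mono ?_
      have : 0 ≤ 2 * (D * (1 + D / r)) * ‖u - v‖ := by positivity
      linarith
    · obtain ⟨m, hm, hum, hmv⟩ := exists_unit_orthogonal_inner_nonneg hu v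
      have hsq : ∀ x y : EuclideanSpace ℝ (Fin 2), ‖x‖ = 1 → ‖y‖ = 1 → 0 ≤ inner ℝ x y →
          ‖x - y‖ ≤ ‖u - v‖ := fun x y hx hy hxy => by
        refine le_of_sq_le_sq ?_ (norm_nonneg _)
        rw [norm_sub_sq_real, norm_sub_sq_real, hx, hy, hu, hv]
        linarith
      refine ((joinedWithin_frontier_of_inner_nonneg hs hr hD hrs hsD hu hm hum.ge).trans
        (joinedWithin_frontier_of_inner_nonneg hs hr hD hrs hsD hm hv hmv)).mono ?_
      rw [two_mul (2 * (D * (1 + D / r)) * ‖u - v‖)]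
      have h1 := hsq u m hu hm hum.ge
      have h2 := hsq m v hm hv hmv
      gcongr
  refine key.mono ?_
  calc _ ≤ 2 * (2 * (D * (1 + D / r)) * (2 / r * dist a b)) := by gcongr
    _ = _ := by ring

lemma CFat.joinedWithin_frontier {c : ℝ} {O : Set (EuclideanSpace ℝ (Fin 2))} (hO : IsOpen O)
    (hconv : Convex ℝ O) (hfat : CFat c (closure O)) {a b : EuclideanSpace ℝ (Fin 2)}
    (ha : a ∈ frontier O) (hb : b ∈ frontier O) :
    JoinedWithin (frontier O) (16 * c * (1 + 2 * c) * dist a b) a b := by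
  obtain ⟨z, w, r, R, hr, hrR, hRc, hz, hw⟩ := hfat
  have hne : O.Nonempty := closure_nonempty_iff.1 ⟨z, hz (Metric.mem_closedBall_self hr.le)⟩
  have hzO : Metric.ball z r ⊆ O := by
    have h1 := interior_maximal (Metric.ball_subset_closedBall.trans hz) Metric.isOpen_ball
    rwa [hconv.interior_closure_eq_interior_of_nonempty_interior (by rwa [hO.interior_eq]),
      hO.interior_eq] at h1
  let e := IsometryEquiv.addLeft z
  have hfr : e ⁻¹' frontier O = frontier (e ⁻¹' O) := e.toHomeomorph.preimage_frontier O
  have hzw := hw (hz (Metric.mem_closedBall_self hr.le))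
  have hc : 0 < c := by
    by_contra! h
    nlinarith
  have key := _root_.joinedWithin_frontier (s := e ⁻¹' O) (r := r) (D := 2 * R) (a := e.symm a)
    (b := e.symm b) (hconv.translate_preimage_right z) hr (by linarith)
    (fun x hx => hzO (by simpa [e] using hx))
    (fun x hx => ?_) (by rw [← hfr]; simpa using ha) (by rw [← hfr]; simpa using hb)
  · have := (key.map (F' := frontier O) e.isometry (by rw [← hfr]; exact Set.mapsTo_preimage _ _))
    rw [e.apply_symm_apply, e.apply_symm_apply, e.symm.isometry.dist_eq] at this
    refine this.mono ?_
    have h2 : 2 * R / r ≤ 2 * c := by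
      rw [div_le_iff₀ hr]
      linarith
    have h0 : 0 ≤ 2 * R / r := by
      have := hr.le.trans hrR
      positivity
    calc _ ≤ 8 * (2 * c) * (1 + 2 * c) * dist a b := by gcongr
      _ = _ := by ring
  · have h1 := hw (subset_closure hx)
    rw [Metric.mem_closedBall] at h1 hzw
    have h2 := dist_triangle_right (e x) z w
    have h3 : dist (e x) z = ‖x‖ := by simp [e, dist_eq_norm]
    rw [mem_closedBall_zero_iff]
    linarith

/-- The segment from a point outside a convex set to a point of its interior first meets the
boundary in a point before which it avoids the set. -/
lemma exists_mem_segment_frontier {E : Type*} [NormedAddCommGroup E] [NormedSpace ℝ E]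
    {O : Set E} (hO : IsOpen O) (hconv : Convex ℝ O) {p x : E} (hp : p ∉ O) (hx : x ∈ O) :
    ∃ a ∈ segment ℝ p x, a ∈ frontier O ∧ Disjoint (segment ℝ p a) O := by
  let ℓ : ℝ → E := AffineMap.lineMap p x
  have hℓ : Continuous ℓ := AffineMap.lineMap_continuous
  have hcpt : IsCompact (Set.Icc (0 : ℝ) 1 ∩ ℓ ⁻¹' Oᶜ) :=
    isCompact_Icc.inter_right (hO.isClosed_compl.preimage hℓ)
  obtain ⟨t, ⟨ht, htO⟩, hmax⟩ := hcpt.exists_isGreatest ⟨0, by simp, by simpa [ℓ] using hp⟩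
  have ht1 : t < 1 := lt_of_le_of_ne ht.2 fun h => htO (by simpa [ℓ, h] using hx)
  have hseg : segment ℝ p x = ℓ '' Set.Icc 0 1 := segment_eq_image_lineMap ℝ p x
  refine ⟨ℓ t, hseg ▸ Set.mem_image_of_mem _ ht, ⟨?_, by rwa [hO.interior_eq]⟩, ?_⟩
  · refine mem_closure_of_tendsto (hℓ.continuousAt.tendsto.mono_left
      (nhdsWithin_le_nhds (s := Set.Ioi t))) ?_
    filter_upwards [Ioo_mem_nhdsGT ht1] with y hy
    by_contra hyO
    exact (hmax ⟨⟨ht.1.trans hy.1.le, hy.2.le⟩, hyO⟩).not_gt hy.1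
  · rw [Set.disjoint_left]
    intro y hy hyO
    have hw : Wbtw ℝ p (ℓ t) x := ⟨t, ht, rfl⟩
    have := hw.trans_left_right (mem_segment_iff_wbtw.1 hy)
    exact htO (hconv.segment_subset hyO hx (mem_segment_iff_wbtw.2 this))

lemma joinedWithin_compl_iUnion {c : ℝ} (hc : 1 < c) {t : ℕ}
    {O : Fin t → Set (EuclideanSpace ℝ (Fin 2))} (hO : ∀ i, IsOpen (O i))
    (hconv : ∀ i, Convex ℝ (O i)) (hdisj : Pairwise fun i j => Disjoint (O i) (O j))
    (hfat : ∀ i, CFat c (closure (O i))) (S : Finset (Fin t)) :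
    ∀ p q : EuclideanSpace ℝ (Fin 2), p ∈ (⋃ i, O i)ᶜ → q ∈ (⋃ i, O i)ᶜ →
      (∀ i, ¬ Disjoint (segment ℝ p q) (O i) → i ∈ S) →
      JoinedWithin (⋃ i, O i)ᶜ (16 * c * (1 + 2 * c) * dist p q) p q := by
  induction S using Finset.strongInduction with
  | H S ih =>
  intro p q hp hq hS
  by_cases h : ∃ i, ¬ Disjoint (segment ℝ p q) (O i)
  · obtain ⟨i, hi⟩ := h
    obtain ⟨x, hx, hxO⟩ := Set.not_disjoint_iff.1 hi
    have hfr : frontier (O i) ⊆ (⋃ j, O j)ᶜ := fun y hy hyU => by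
      obtain ⟨j, hj⟩ := Set.mem_iUnion.1 hyU
      by_cases hij : i = j
      · exact hy.2 ((hO i).interior_eq.symm ▸ hij ▸ hj)
      · exact Set.disjoint_left.1 ((hdisj hij).closure_left (hO j)) hy.1 hj
    have hout : ∀ y ∈ (⋃ j, O j)ᶜ, y ∉ O i := fun y hy h => hy (Set.mem_iUnion_of_mem i h)
    obtain ⟨a, hax, haf, hapO⟩ := exists_mem_segment_frontier (hO i) (hconv i) (hout p hp) hxO
    obtain ⟨b, hbx, hbf, hbqO⟩ := exists_mem_segment_frontier (hO i) (hconv i) (hout q hq) hxO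
    rw [segment_symm] at hbqO
    have hpx : segment ℝ p x ⊆ segment ℝ p q :=
      (convex_segment p q).segment_subset (left_mem_segment ℝ p q) hx
    have hqx : segment ℝ q x ⊆ segment ℝ p q :=
      (convex_segment p q).segment_subset (right_mem_segment ℝ p q) hx
    have hstep : ∀ p' q', p' ∈ (⋃ j, O j)ᶜ → q' ∈ (⋃ j, O j)ᶜ → p' ∈ segment ℝ p q →
        q' ∈ segment ℝ p q → Disjoint (segment ℝ p' q') (O i) →
        JoinedWithin (⋃ i, O i)ᶜ (16 * c * (1 + 2 * c) * dist p' q') p' q' := by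
      intro p' q' hp' hq' hps hqs hd
      refine ih (S.erase i) (Finset.erase_ssubset (hS i hi)) p' q' hp' hq' fun j hj => ?_
      refine Finset.mem_erase.2 ⟨fun hji => hj (hji ▸ hd), hS j fun hd' => hj ?_⟩
      exact hd'.mono_left ((convex_segment p q).segment_subset hps hqs)
    have h1 := hstep p a hp (hfr haf) (left_mem_segment ℝ p q) (hpx hax) hapO
    have h3 := hstep b q (hfr hbf) hq (hqx hbx) (right_mem_segment ℝ p q) hbqO
    have h2 := (CFat.joinedWithin_frontier (hO i) (hconv i) (hfat i) haf hbf).map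
      isometry_id hfr
    refine ((h1.trans h2).trans h3).mono ?_
    rw [← mul_add, ← mul_add]
    have e1 := dist_add_dist_of_mem_segment hax
    have e2 := dist_add_dist_of_mem_segment hbx
    have e3 := dist_add_dist_of_mem_segment hx
    have e4 := dist_triangle_right a b x
    rw [dist_comm q b, dist_comm q x] at e2
    refine mul_le_mul_of_nonneg_left ?_ (by positivity)
    linarith
  · push Not at h
    refine (joinedWithin_of_segment_subset ?_).mono (le_mul_of_one_le_left dist_nonneg ?_)
    · exact Set.subset_compl_iff_disjoint_right.2 (Set.disjoint_iUnion_right.2 h)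
    · nlinarith

/-- For every `c > 1` there is a constant `k ≥ 1` such that for any finite family of pairwise
disjoint open convex obstacles in the plane whose closures are `c`-fat compact convex sets,
and any two points `p, q` outside all obstacles, there is a continuous path from `p` to `q`
avoiding all obstacles of length at most `k * dist p q`. -/
theorem path_avoiding_cFat_obstacles (c : ℝ) (hc : 1 < c) :
    ∃ k : ℝ, 1 ≤ k ∧
      ∀ (t : ℕ) (O : Fin t → Set (EuclideanSpace ℝ (Fin 2))),
        (∀ i, IsOpen (O i)) → (∀ i, Convex ℝ (O i)) →
        (Pairwise fun i j => Disjoint (O i) (O j)) →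
        (∀ i, IsCompact (closure (O i))) →
        (∀ i, Convex ℝ (closure (O i))) →
        (∀ i, CFat c (closure (O i))) →
        ∀ p q : EuclideanSpace ℝ (Fin 2),
          (∀ i, p ∉ O i) → (∀ i, q ∉ O i) →
          ∃ γ : ℝ → EuclideanSpace ℝ (Fin 2),
            ContinuousOn γ (Set.Icc 0 1) ∧ γ 0 = p ∧ γ 1 = q ∧
            (∀ i, Disjoint (γ '' Set.Icc 0 1) (O i)) ∧
            eVariationOn γ (Set.Icc 0 1) ≤ ENNReal.ofReal (k * dist p q) := by
  refine ⟨16 * c * (1 + 2 * c), by nlinarith, fun t O hO hconv hdisj _ _ hfat p q hp hq => ?_⟩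
  obtain ⟨γ, hγ, h0, h1, hF, hlen⟩ := (joinedWithin_compl_iUnion hc hO hconv hdisj hfat
    Finset.univ p q (by simpa using hp) (by simpa using hq) (by simp)).exists_path
  exact ⟨γ, hγ, h0, h1, fun i => (Set.subset_compl_iff_disjoint_right.1 hF).mono_right
    (Set.subset_iUnion O i), hlen⟩
end

section
/- Let λ be a real with 0 < λ ≤ 1, let o ∈ ℝ², and set x = 3λ/2, y = λ/4. Define eight open axis-parallel squares of side length x (i.e., open squares of the form (u − x/2, u + x/2) × (v − x/2, v + x/2)) with centers o + (0, λ + x/2), o + (0, −(λ + x/2)), o + (λ + x/2, 0), o + (−(λ + x/2), 0), o + (x + y, λ + x/2), o + (−(x + y), λ + x/2), o + (x + y, −(λ + x/2)), and o + (−(x + y), −(λ + x/2)). Let S(o) be the closed square o + [−5λ/2, 5λ/2] × [−5λ/2, 5λ/2]. Then for every point p ∈ ℝ² with p ∉ S(o), the closed segment joining p and o intersects at least one of the eight open squares. -/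
/-- On the ray from the origin through `(a, b)` with `|a| ≤ b` and `5 * l / 2 < b`, there is a point
between the origin and `(a, b)` lying in the middle, the right or the left upper square. -/
lemma exists_scale_mem_upper_squares {l a b : ℝ} (hl : 0 < l) (hb : 5 * l / 2 < b)
    (hab : |a| ≤ b) :
    ∃ s : ℝ, 0 ≤ s ∧ s ≤ 1 ∧ l < s * b ∧ s * b < 5 * l / 2 ∧
      ((-(3 * l / 4) < s * a ∧ s * a < 3 * l / 4) ∨ (l < s * a ∧ s * a < 5 * l / 2) ∨
        (-(5 * l / 2) < s * a ∧ s * a < -l)) := by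
  have hb0 : 0 < b := by linarith
  obtain ⟨h₁, h₂⟩ := abs_le.mp hab
  have scale : ∀ h : ℝ, 0 < h → h ≤ 5 * l / 2 →
      ∃ s : ℝ, 0 < s ∧ s ≤ 1 ∧ s * b = h := fun h h0 hh =>
    ⟨h / b, by positivity, (div_le_one hb0).2 (by linarith), div_mul_cancel₀ h hb0.ne'⟩
  by_cases hmid : |a| ≤ b / 2
  · obtain ⟨s, hs0, hs1, hs⟩ := scale (5 * l / 4) (by linarith) (by linarith)
    obtain ⟨h₃, h₄⟩ := abs_le.mp hmid
    have := mul_le_mul_of_nonneg_left h₃ hs0.le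
    have := mul_le_mul_of_nonneg_left h₄ hs0.le
    exact ⟨s, hs0.le, hs1, by linarith, by linarith, Or.inl ⟨by linarith, by linarith⟩⟩
  · obtain ⟨s, hs0, hs1, hs⟩ := scale (9 * l / 4) (by linarith) (by linarith)
    have := mul_le_mul_of_nonneg_left h₁ hs0.le
    have := mul_le_mul_of_nonneg_left h₂ hs0.le
    refine ⟨s, hs0.le, hs1, by linarith, by linarith, Or.inr ?_⟩
    rcases lt_abs.mp (not_le.mp hmid) with h | h
    · have := mul_lt_mul_of_pos_left h hs0
      exact Or.inl ⟨by linarith, by linarith⟩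
    · have := mul_lt_mul_of_pos_left h hs0
      exact Or.inr ⟨by linarith, by linarith⟩

/-- The gadget lemma: for `0 < λ ≤ 1`, `x = 3λ/2`, `y = λ/4`, any point `p` outside the closed
square `S(o)` of side `5λ` centered at `o` has its segment to `o` intersect one of the eight
open squares of side `x` of the gadget `G(o)`. -/
theorem gadget_blocks_sight (lam : ℝ) (hlam : 0 < lam) (hlam1 : lam ≤ 1) (o : ℝ × ℝ) :
    ∀ (x y : ℝ), x = 3 * lam / 2 → y = lam / 4 →
    ∀ sq : ℝ × ℝ → Set (ℝ × ℝ),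
      (∀ c : ℝ × ℝ,
        sq c = Set.Ioo (c.1 - x / 2) (c.1 + x / 2) ×ˢ Set.Ioo (c.2 - x / 2) (c.2 + x / 2)) →
    ∀ centers : List (ℝ × ℝ),
      centers = [o + (0, lam + x / 2), o + (0, -(lam + x / 2)),
                 o + (lam + x / 2, 0), o + (-(lam + x / 2), 0),
                 o + (x + y, lam + x / 2), o + (-(x + y), lam + x / 2),
                 o + (x + y, -(lam + x / 2)), o + (-(x + y), -(lam + x / 2))] →
    ∀ S : Set (ℝ × ℝ),
      S = Set.Icc (o.1 - 5 * lam / 2) (o.1 + 5 * lam / 2) ×ˢ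
          Set.Icc (o.2 - 5 * lam / 2) (o.2 + 5 * lam / 2) →
    ∀ p : ℝ × ℝ, p ∉ S → ∃ c ∈ centers, (segment ℝ p o ∩ sq c).Nonempty := by
  rintro x y rfl rfl sq hsq centers rfl S rfl ⟨p₁, p₂⟩ hp
  obtain ⟨o₁, o₂⟩ := o
  have meets : ∀ s : ℝ, 0 ≤ s → s ≤ 1 → ∀ c : ℝ × ℝ,
      c.1 - 3 * lam / 4 < o₁ + s * (p₁ - o₁) → o₁ + s * (p₁ - o₁) < c.1 + 3 * lam / 4 →
      c.2 - 3 * lam / 4 < o₂ + s * (p₂ - o₂) → o₂ + s * (p₂ - o₂) < c.2 + 3 * lam / 4 →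
      (segment ℝ (p₁, p₂) (o₁, o₂) ∩ sq c).Nonempty := by
    intro s hs0 hs1 c h₁ h₂ h₃ h₄
    refine ⟨(o₁ + s * (p₁ - o₁), o₂ + s * (p₂ - o₂)),
      ⟨s, 1 - s, hs0, by linarith, by ring, ?_⟩, ?_⟩
    · ext <;> simp <;> ring
    · rw [hsq]
      exact ⟨⟨by linarith, by linarith⟩, ⟨by linarith, by linarith⟩⟩
  have hfar : 5 * lam / 2 < |p₁ - o₁| ∨ 5 * lam / 2 < |p₂ - o₂| := by
    by_contra! h
    obtain ⟨h₁, h₂⟩ := h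
    rw [abs_le] at h₁ h₂
    exact hp ⟨⟨by linarith, by linarith⟩, ⟨by linarith, by linarith⟩⟩
  simp only [List.mem_cons, List.not_mem_nil, or_false, exists_eq_or_imp, exists_eq_left]
  rcases le_total |p₁ - o₁| |p₂ - o₂| with hle | hle
  · have hbig : 5 * lam / 2 < |p₂ - o₂| := hfar.elim (fun h => h.trans_le hle) id
    rcases abs_cases (p₂ - o₂) with ⟨he, -⟩ | ⟨he, -⟩ <;> rw [he] at hle hbig <;>
      obtain ⟨s, hs0, hs1, hlo, hhi, h | h | h⟩ := exists_scale_mem_upper_squares hlam hbig hle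
    · refine Or.inl (meets s hs0 hs1 _ ?_ ?_ ?_ ?_) <;> simp only [Prod.mk_add_mk] <;> linarith
    · refine Or.inr <| Or.inr <| Or.inr <| Or.inr <| Or.inl (meets s hs0 hs1 _ ?_ ?_ ?_ ?_) <;>
        simp only [Prod.mk_add_mk] <;> linarith
    · refine Or.inr <| Or.inr <| Or.inr <| Or.inr <| Or.inr <| Or.inl
        (meets s hs0 hs1 _ ?_ ?_ ?_ ?_) <;> simp only [Prod.mk_add_mk] <;> linarith
    · refine Or.inr <| Or.inl (meets s hs0 hs1 _ ?_ ?_ ?_ ?_) <;>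
        simp only [Prod.mk_add_mk] <;> linarith
    · refine Or.inr <| Or.inr <| Or.inr <| Or.inr <| Or.inr <| Or.inr <| Or.inl
        (meets s hs0 hs1 _ ?_ ?_ ?_ ?_) <;> simp only [Prod.mk_add_mk] <;> linarith
    · refine Or.inr <| Or.inr <| Or.inr <| Or.inr <| Or.inr <| Or.inr <| Or.inr
        (meets s hs0 hs1 _ ?_ ?_ ?_ ?_) <;> simp only [Prod.mk_add_mk] <;> linarith
  · have hbig : 5 * lam / 2 < |p₁ - o₁| := hfar.elim id (fun h => h.trans_le hle)
    rcases abs_cases (p₁ - o₁) with ⟨he, -⟩ | ⟨he, -⟩ <;> rw [he] at hle hbig <;>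
      obtain ⟨s, hs0, hs1, hlo, hhi, h | h | h⟩ := exists_scale_mem_upper_squares hlam hbig hle
    · refine Or.inr <| Or.inr <| Or.inl (meets s hs0 hs1 _ ?_ ?_ ?_ ?_) <;>
        simp only [Prod.mk_add_mk] <;> linarith
    · refine Or.inr <| Or.inr <| Or.inr <| Or.inr <| Or.inl (meets s hs0 hs1 _ ?_ ?_ ?_ ?_) <;>
        simp only [Prod.mk_add_mk] <;> linarith
    · refine Or.inr <| Or.inr <| Or.inr <| Or.inr <| Or.inr <| Or.inr <| Or.inl
        (meets s hs0 hs1 _ ?_ ?_ ?_ ?_) <;> simp only [Prod.mk_add_mk] <;> linarith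
    · refine Or.inr <| Or.inr <| Or.inr <| Or.inl (meets s hs0 hs1 _ ?_ ?_ ?_ ?_) <;>
        simp only [Prod.mk_add_mk] <;> linarith
    · refine Or.inr <| Or.inr <| Or.inr <| Or.inr <| Or.inr <| Or.inl
        (meets s hs0 hs1 _ ?_ ?_ ?_ ?_) <;> simp only [Prod.mk_add_mk] <;> linarith
    · refine Or.inr <| Or.inr <| Or.inr <| Or.inr <| Or.inr <| Or.inr <| Or.inr
        (meets s hs0 hs1 _ ?_ ?_ ?_ ?_) <;> simp only [Prod.mk_add_mk] <;> linarith
end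

section
/- Let X be a metric space, let d > 0 be a real number, and let P be a finite set of points of X whose elements are pairwise at distance at least d. Let A be a finite nonempty set, let a : P → A be any function, and for each s ∈ A let γ_s : ℝ → X be a map such that every p ∈ P lies in the image of γ_{a(p)}. Then there exists s ∈ A such that the total variation of γ_s over ℝ is at least (⌈|P| / |A|⌉ − 1) · d. -/
/-- If a map sends a finite subset of `s` to points that are pairwise at distance at least `c`,
then its variation on `s` is at least `c` times the number of gaps in the finite set. -/
theorem eVariationOn.card_sub_one_mul_le {α E : Type*} [LinearOrder α] [PseudoEMetricSpace E]
    (f : α → E) {s : Set α} (T : Finset α) (hTs : (T : Set α) ⊆ s) {c : ENNReal}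
    (hT : (T : Set α).Pairwise fun x y => c ≤ edist (f x) (f y)) :
    ((T.card - 1 : ℕ) : ENNReal) * c ≤ eVariationOn f s := by
  obtain hm | ⟨m, hm⟩ : T.card = 0 ∨ ∃ m, T.card = m + 1 := by
    cases T.card <;> simp
  · simp [hm]
  let e := T.orderEmbOfFin hm
  let u : ℕ → α := fun i => e ⟨min i m, by omega⟩
  have hu : Monotone u := fun i j hij => e.monotone (Fin.mk_le_mk.2 (min_le_min_right m hij))
  have huT : ∀ i, u i ∈ T := fun i => T.orderEmbOfFin_mem hm _
  calc ((T.card - 1 : ℕ) : ENNReal) * c = ∑ _i ∈ Finset.range m, c := by simp [hm]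
    _ ≤ ∑ i ∈ Finset.range m, edist (f (u (i + 1))) (f (u i)) := by
        refine Finset.sum_le_sum fun i hi => hT (huT _) (huT _) fun h => ?_
        have := congrArg Fin.val (e.injective h)
        simp only [Finset.mem_range] at hi this
        omega
    _ ≤ eVariationOn f s := eVariationOn.sum_le hu fun i => hTs (huT i)

/-- Pigeonhole lower bound: if the points of a finite set `P`, pairwise at distance at least
`d > 0`, are each visited by the trajectory corresponding to their advice string `a p ∈ A`,
then some advice string `s ∈ A` yields a trajectory of total variation at least
`(⌈|P| / |A|⌉ - 1) * d`. -/
theorem exists_long_trajectory {X : Type*} [MetricSpace X] {S : Type*}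
    (d : ℝ) (hd : 0 < d)
    (P : Finset X) (hP : ∀ p ∈ P, ∀ q ∈ P, p ≠ q → d ≤ dist p q)
    (A : Finset S) (hA : A.Nonempty)
    (a : X → S) (ha : ∀ p ∈ P, a p ∈ A)
    (γ : S → ℝ → X) (hγ : ∀ p ∈ P, ∃ t : ℝ, γ (a p) t = p) :
    ∃ s ∈ A,
      ENNReal.ofReal (((⌈(P.card : ℚ) / (A.card : ℚ)⌉ : ℝ) - 1) * d)
        ≤ eVariationOn (γ s) Set.univ := by
  classical
  have hA0 : (0 : ℚ) < A.card := by exact_mod_cast hA.card_pos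
  obtain ⟨s, hs, hcard⟩ := Finset.exists_le_card_fiber_of_nsmul_le_card_of_maps_to
    (b := (P.card : ℚ) / A.card) ha hA (by rw [nsmul_eq_mul, mul_div_cancel₀ _ hA0.ne'])
  refine ⟨s, hs, ?_⟩
  set Q := P.filter fun x => a x = s
  have hvisit : ∀ p : X, ∃ t : ℝ, p ∈ Q → γ s t = p := by
    intro p
    by_cases hp : p ∈ Q
    · obtain ⟨hpP, rfl⟩ := Finset.mem_filter.1 hp
      exact (hγ p hpP).imp fun _ ht _ => ht
    · exact ⟨0, fun h => absurd h hp⟩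
  choose t ht using hvisit
  have hinj : Set.InjOn t Q := fun p hp q hq hpq => by rw [← ht p hp, hpq, ht q hq]
  have hsep : ((Q.image t : Finset ℝ) : Set ℝ).Pairwise
      fun x y => ENNReal.ofReal d ≤ edist (γ s x) (γ s y) := by
    intro x hx y hy hxy
    obtain ⟨p, hp, rfl⟩ := Finset.mem_image.1 hx
    obtain ⟨q, hq, rfl⟩ := Finset.mem_image.1 hy
    rw [ht p hp, ht q hq, edist_dist]
    exact ENNReal.ofReal_le_ofReal
      (hP p (Finset.mem_filter.1 hp).1 q (Finset.mem_filter.1 hq).1 (ne_of_apply_ne t hxy))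
  have hceil : (⌈(P.card : ℚ) / (A.card : ℚ)⌉ : ℝ) ≤ Q.card := by
    have h : ⌈(P.card : ℚ) / (A.card : ℚ)⌉ ≤ (Q.card : ℤ) :=
      Int.ceil_le.2 (by rwa [Int.cast_natCast])
    simpa only [Int.cast_natCast] using (Int.cast_le (R := ℝ)).2 h
  have hpred : (Q.card : ℝ) ≤ (Q.card - 1 : ℕ) + 1 := by
    exact_mod_cast le_tsub_add
  calc ENNReal.ofReal (((⌈(P.card : ℚ) / (A.card : ℚ)⌉ : ℝ) - 1) * d)
      ≤ ENNReal.ofReal ((Q.card - 1 : ℕ) * d) :=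
        ENNReal.ofReal_le_ofReal (mul_le_mul_of_nonneg_right (by linarith) hd.le)
    _ = ((Q.image t).card - 1 : ℕ) * ENNReal.ofReal d := by
        rw [Finset.card_image_of_injOn hinj, ENNReal.ofReal_mul (Nat.cast_nonneg _),
          ENNReal.ofReal_natCast]
    _ ≤ eVariationOn (γ s) Set.univ :=
        eVariationOn.card_sub_one_mul_le (γ s) _ (Set.subset_univ _) hsep
end

section
/- There exists an injective function Code from the set of triples (a₁, a₂, a₃) of integers with a₁ ≥ 1, a₂ ≠ 0 and a₃ ≠ 0 into the set of finite binary strings (List Bool), such that for every such triple the length of Code(a₁, a₂, a₃) is at most 14 + 2·(Nat.log 2 a₁.natAbs + Nat.log 2 a₂.natAbs + Nat.log 2 a₃.natAbs). -/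
/-- A self-delimiting encoding of binary strings: each bit is preceded by `true`, and the end is
marked by `false`. -/
def selfDelimit : List Bool → List Bool
  | [] => [false]
  | b :: l => true :: b :: selfDelimit l

theorem length_selfDelimit (l : List Bool) : (selfDelimit l).length = 2 * l.length + 1 := by
  induction l with
  | nil => rfl
  | cons b l ih => simp only [selfDelimit, List.length_cons, ih]; ring

theorem selfDelimit_append_inj {l m x y : List Bool}
    (h : selfDelimit l ++ x = selfDelimit m ++ y) : l = m ∧ x = y := by
  induction l generalizing m with
  | nil => cases m <;> simp_all [selfDelimit]
  | cons b l ih =>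
    cases m with
    | nil => simp [selfDelimit] at h
    | cons c m =>
      simp only [selfDelimit, List.cons_append, List.cons.injEq, true_and] at h
      obtain ⟨hl, hx⟩ := ih h.2
      exact ⟨by rw [h.1, hl], hx⟩

theorem Nat.bits_injective : Function.Injective Nat.bits := by
  intro m
  induction m using Nat.binaryRec' with
  | zero =>
    intro n h
    have hsize : n.size = 0 := by rw [← Nat.size_eq_bits_len, ← h]; simp
    exact (Nat.size_eq_zero.mp hsize).symm
  | bit b m hm ih =>
    intro n h
    induction n using Nat.binaryRec' with
    | zero => rw [Nat.bits_append_bit m b hm] at h; simp at h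
    | bit c n hn _ =>
      rw [Nat.bits_append_bit m b hm, Nat.bits_append_bit n c hn, List.cons.injEq] at h
      rw [h.1, ih h.2]

theorem Nat.length_bits_le (n : ℕ) : n.bits.length ≤ Nat.log 2 n + 1 := by
  rw [Nat.size_eq_bits_len, Nat.size_le]
  exact Nat.lt_pow_succ_log_self one_lt_two n

/-- A prefix-free binary encoding of the integers: a sign bit followed by the self-delimited binary
expansion of the absolute value. -/
def Int.prefixCode (a : ℤ) : List Bool :=
  decide (0 ≤ a) :: selfDelimit a.natAbs.bits

theorem Int.length_prefixCode_le (a : ℤ) :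
    a.prefixCode.length ≤ 2 * Nat.log 2 a.natAbs + 4 := by
  have := Nat.length_bits_le a.natAbs
  rw [Int.prefixCode, List.length_cons, length_selfDelimit]
  omega

theorem Int.prefixCode_append_inj {a b : ℤ} {x y : List Bool}
    (h : a.prefixCode ++ x = b.prefixCode ++ y) : a = b ∧ x = y := by
  simp only [Int.prefixCode, List.cons_append, List.cons.injEq, decide_eq_decide] at h
  obtain ⟨hbits, hx⟩ := selfDelimit_append_inj h.2
  have habs := Nat.bits_injective hbits
  have hsign := h.1
  exact ⟨by omega, hx⟩

/-- Coding lemma: triples `(a₁, a₂, a₃)` of integers with `a₁ ≥ 1` and `a₂, a₃ ≠ 0` can be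
injectively encoded as binary strings of length at most
`14 + 2·(log₂ a₁ + log₂ |a₂| + log₂ |a₃|)`. -/
theorem exists_code :
    ∃ Code : ℤ → ℤ → ℤ → List Bool,
      Set.InjOn (fun t : ℤ × ℤ × ℤ => Code t.1 t.2.1 t.2.2)
        {t : ℤ × ℤ × ℤ | 1 ≤ t.1 ∧ t.2.1 ≠ 0 ∧ t.2.2 ≠ 0} ∧
      ∀ a₁ a₂ a₃ : ℤ, 1 ≤ a₁ → a₂ ≠ 0 → a₃ ≠ 0 →
        (Code a₁ a₂ a₃).length ≤
          14 + 2 * (Nat.log 2 a₁.natAbs + Nat.log 2 a₂.natAbs + Nat.log 2 a₃.natAbs) := by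
  refine ⟨fun a₁ a₂ a₃ => a₁.prefixCode ++ (a₂.prefixCode ++ (a₃.prefixCode ++ [])), ?_, ?_⟩
  · rintro ⟨a₁, a₂, a₃⟩ _ ⟨b₁, b₂, b₃⟩ _ h
    obtain ⟨h₁, h⟩ := Int.prefixCode_append_inj h
    obtain ⟨h₂, h⟩ := Int.prefixCode_append_inj h
    obtain ⟨h₃, _⟩ := Int.prefixCode_append_inj h
    exact Prod.ext h₁ (Prod.ext h₂ h₃)
  · intro a₁ a₂ a₃ _ _ _
    have h₁ := a₁.length_prefixCode_le
    have h₂ := a₂.length_prefixCode_le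
    have h₃ := a₃.length_prefixCode_le
    simp only [List.length_append, List.length_nil]
    omega
end
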